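/- arXiv:2210.05446 — 2 statements merged into one kernel-verified Lean document; each statement's English description precedes it below -/
import Mathlib

section
/- Let (Ω,P) be a probability space and let (W,V) : Ω → ℝ² have a centered bivariate Gaussian law with Var(W) = σ_WW > 0 and Cov(V,W) = σ_VW. Then the conditional expectation of V given the σ-algebra generated by W satisfies E[V | σ(W)] = (σ_VW/σ_WW) · W almost surely. -/
open MeasureTheory ProbabilityTheory Matrix

/-- The standard Gaussian product measure on `ℝ^n`. -/
noncomputable def stdGaussianPi (n : ℕ) : Measure (Fin n → ℝ) :=
  Measure.pi fun _ => gaussianReal 0 1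

/-- `μ` is the centered multivariate Gaussian measure on `ℝ^n` with covariance matrix `S`. -/
def IsCenteredGaussian {n : ℕ} (μ : Measure (Fin n → ℝ))
    (S : Matrix (Fin n) (Fin n) ℝ) : Prop :=
  ∃ A : Matrix (Fin n) (Fin n) ℝ, S = A * Aᵀ ∧ μ = (stdGaussianPi n).map A.mulVec

instance isGaussian_stdGaussianPi (n : ℕ) : IsGaussian (stdGaussianPi n) := by
  have hlaw (i : Fin n) : HasGaussianLaw (fun x : Fin n → ℝ ↦ x i) (stdGaussianPi n) :=
    (measurePreserving_eval (fun _ : Fin n ↦ gaussianReal 0 1) i).hasLaw.hasGaussianLaw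
  have hindep : iIndepFun (fun (i : Fin n) (x : Fin n → ℝ) ↦ x i) (stdGaussianPi n) :=
    iIndepFun_pi (X := fun _ x ↦ x) fun _ ↦ aemeasurable_id
  simpa using (iIndepFun.hasGaussianLaw hlaw hindep).isGaussian_map

lemma memLp_eval_stdGaussianPi {n : ℕ} (i : Fin n) :
    MemLp (fun x : Fin n → ℝ ↦ x i) 2 (stdGaussianPi n) :=
  (HasGaussianLaw.eval (X := fun i (x : Fin n → ℝ) ↦ x i)
    (IsGaussian.hasGaussianLaw_id (μ := stdGaussianPi n)) i).memLp_two

lemma integral_eval_stdGaussianPi {n : ℕ} (i : Fin n) :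
    ∫ x, x i ∂(stdGaussianPi n) = 0 := by
  have h := (measurePreserving_eval (fun _ : Fin n ↦ gaussianReal 0 1) i).hasLaw.integral_eq
  rw [integral_id_gaussianReal] at h
  exact h

lemma covariance_eval_stdGaussianPi {n : ℕ} (i j : Fin n) :
    cov[fun x ↦ x i, fun x ↦ x j; stdGaussianPi n] = if i = j then 1 else 0 := by
  split_ifs with hij
  · subst hij
    have h := (measurePreserving_eval (fun _ : Fin n ↦ gaussianReal 0 1) i).hasLaw.variance_eq
    rw [covariance_self (measurable_pi_apply i).aemeasurable]
    rw [variance_id_gaussianReal] at h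
    exact h
  · have hindep : iIndepFun (fun (i : Fin n) (x : Fin n → ℝ) ↦ x i) (stdGaussianPi n) :=
      iIndepFun_pi (X := fun _ x ↦ x) fun _ ↦ aemeasurable_id
    exact (hindep.indepFun hij).covariance_eq_zero (memLp_eval_stdGaussianPi i)
      (memLp_eval_stdGaussianPi j)

namespace IsCenteredGaussian

variable {n : ℕ} {μ : Measure (Fin n → ℝ)} {S : Matrix (Fin n) (Fin n) ℝ}

lemma isGaussian (h : IsCenteredGaussian μ S) : IsGaussian μ := by
  obtain ⟨A, -, rfl⟩ := h
  exact isGaussian_map (LinearMap.toContinuousLinearMap A.mulVecLin)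

lemma integral_eval (h : IsCenteredGaussian μ S) (i : Fin n) : ∫ x, x i ∂μ = 0 := by
  obtain ⟨A, -, rfl⟩ := h
  rw [integral_map (f := fun x : Fin n → ℝ ↦ x i) (by fun_prop)
    (measurable_pi_apply i).aestronglyMeasurable]
  simp only [Matrix.mulVec, dotProduct]
  rw [integral_finsetSum _ fun j _ ↦
    ((memLp_eval_stdGaussianPi j).integrable one_le_two).const_mul _]
  simp [integral_const_mul, integral_eval_stdGaussianPi]

lemma covariance_eval (h : IsCenteredGaussian μ S) (i j : Fin n) :
    cov[fun x ↦ x i, fun x ↦ x j; μ] = S i j := by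
  obtain ⟨A, rfl, rfl⟩ := h
  rw [covariance_map_fun (measurable_pi_apply i).aestronglyMeasurable
    (measurable_pi_apply j).aestronglyMeasurable (by fun_prop)]
  simp only [Matrix.mulVec, dotProduct]
  rw [covariance_fun_sum_fun_sum (fun k ↦ (memLp_eval_stdGaussianPi k).const_mul _)
    (fun k ↦ (memLp_eval_stdGaussianPi k).const_mul _)]
  simp [covariance_const_mul_left, covariance_const_mul_right, covariance_eval_stdGaussianPi,
    Matrix.mul_apply, mul_comm]

end IsCenteredGaussian

/-- For a jointly Gaussian centered pair `(W, V)`, the conditional expectation of `V` given `W` is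
the linear regression of `V` on `W`. -/
lemma condExp_comap_ae_eq_of_hasGaussianLaw {Ω : Type*} [MeasurableSpace Ω] {P : Measure Ω}
    {W V : Ω → ℝ} (hW : Measurable W) (hV : Measurable V)
    (h : HasGaussianLaw (fun ω ↦ (W ω, V ω)) P) (hW₀ : P[W] = 0) (hV₀ : P[V] = 0)
    (hvar : cov[W, W; P] ≠ 0) :
    P[V | MeasurableSpace.comap W inferInstance]
      =ᵐ[P] fun ω ↦ (cov[V, W; P] / cov[W, W; P]) * W ω := by
  have := h.isProbabilityMeasure
  set c := cov[V, W; P] / cov[W, W; P] with hc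
  set R : Ω → ℝ := fun ω ↦ V ω - c * W ω with hR
  have hWL : MemLp W 2 P := h.fst.memLp_two
  have hVL : MemLp V 2 P := h.snd.memLp_two
  have hcW : Integrable (fun ω ↦ c * W ω) P := (hWL.integrable one_le_two).const_mul c
  have hRi : Integrable R P := (hVL.integrable one_le_two).sub hcW
  have hRm : Measurable R := hV.sub (hW.const_mul c)
  have hRW : HasGaussianLaw (fun ω ↦ (R ω, W ω)) P :=
    h.map_fun ((ContinuousLinearMap.snd ℝ ℝ ℝ - c • ContinuousLinearMap.fst ℝ ℝ ℝ).prod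
      (ContinuousLinearMap.fst ℝ ℝ ℝ))
  have hindep : IndepFun R W P := by
    refine hRW.indepFun_of_covariance_eq_zero ?_
    rw [hR, covariance_fun_sub_left hVL (hWL.const_mul c) hWL, covariance_const_mul_left, hc]
    field_simp
    ring
  have hR₀ : P[R] = 0 := by
    rw [hR, integral_sub (hVL.integrable one_le_two) hcW, integral_const_mul, hW₀, hV₀]
    simp
  have hRcond : P[R | MeasurableSpace.comap W inferInstance] =ᵐ[P] fun _ ↦ P[R] :=
    condExp_indep_eq hRm.comap_le hW.comap_le
      (comap_measurable R).stronglyMeasurable hindep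
  have hWcond : P[fun ω ↦ c * W ω | MeasurableSpace.comap W inferInstance] = fun ω ↦ c * W ω :=
    condExp_of_stronglyMeasurable hW.comap_le
      ((comap_measurable W).const_mul c).stronglyMeasurable hcW
  have hsum : V = R + fun ω ↦ c * W ω := by
    ext ω
    simp [hR]
  have hadd := condExp_add hRi hcW (MeasurableSpace.comap W inferInstance)
  rw [← hsum, hWcond] at hadd
  filter_upwards [hadd, hRcond] with ω h₁ h₂
  rw [h₁, Pi.add_apply, h₂, hR₀, zero_add]

/-- Conditional expectation in a centered bivariate Gaussian: if `(W, V)` is centered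
Gaussian on `ℝ²` with `Var(W) = S 0 0 > 0` and `Cov(V, W) = S 1 0`, then
`E[V | σ(W)] = (σ_VW / σ_WW) · W` a.s.  Index convention: `0 = W`, `1 = V`. -/
theorem condexp_bivariate_gaussian_linear
    {Ω : Type*} [MeasurableSpace Ω] (P : Measure Ω) [IsProbabilityMeasure P]
    (W V : Ω → ℝ) (hW : Measurable W) (hV : Measurable V)
    (S : Matrix (Fin 2) (Fin 2) ℝ)
    (hlaw : IsCenteredGaussian (P.map (fun ω => ![W ω, V ω])) S)
    (hWW : 0 < S 0 0) :
    P[V | MeasurableSpace.comap W inferInstance]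
      =ᵐ[P] fun ω => (S 1 0 / S 0 0) * W ω := by
  have hZ : AEMeasurable (fun ω => ![W ω, V ω]) P :=
    (measurable_pi_iff.2 fun i ↦ by fin_cases i <;> simpa).aemeasurable
  have hG : HasGaussianLaw (fun ω i ↦ ![W ω, V ω] i) P := ⟨hlaw.isGaussian⟩
  have hint := hlaw.integral_eval
  have hcov := hlaw.covariance_eval
  simp only [integral_map hZ (measurable_pi_apply _).aestronglyMeasurable] at hint
  simp only [covariance_map_fun (measurable_pi_apply _).aestronglyMeasurable
    (measurable_pi_apply _).aestronglyMeasurable hZ] at hcov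
  have h00 : cov[W, W; P] = S 0 0 := hcov 0 0
  have h10 : cov[V, W; P] = S 1 0 := hcov 1 0
  rw [← h00, ← h10]
  exact condExp_comap_ae_eq_of_hasGaussianLaw hW hV (hG.prodMk 0 1) (hint 0) (hint 1)
    (h00 ▸ hWW.ne')
end

section
/- Let (Ω,P) and (Ω',P') be probability spaces. Let C : Ω → ℝ^d be measurable with law μ, U : Ω → ℝ integrable with E[U] = 0 and independent of C, and f : ℝ^d → ℝ measurable with f ∘ C integrable; let C' : Ω' → ℝ^d with law μ', U' integrable with E[U'] = 0 and independent of C', and g : ℝ^d → ℝ measurable with g ∘ C' integrable. If the law of (C, f(C)+U) under P equals the law of (C', g(C')+U') under P', then μ = μ' and f = g μ-almost everywhere. (Thus a structural function is disentangled from zero-mean noise that is independent of the covariates.) -/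
open MeasureTheory ProbabilityTheory

/-- A real random variable independent of `X` with zero mean integrates to zero over every
event determined by `X`. -/
lemma setIntegral_preimage_eq_zero_of_indepFun
    {Ω E : Type*} [MeasurableSpace Ω] [MeasurableSpace E] {P : Measure Ω}
    {X : Ω → E} (hX : Measurable X) {U : Ω → ℝ} (hU : Integrable U P)
    (hmean : ∫ ω, U ω ∂P = 0) (hindep : IndepFun U X P) {s : Set E} (hs : MeasurableSet s) :
    ∫ ω in X ⁻¹' s, U ω ∂P = 0 := by
  have h := Indep.setIntegral_eq_mul (f := id) hX.comap_le hindep.symm hU.aemeasurable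
    ⟨s, hs, rfl⟩ aestronglyMeasurable_id
  simpa [hmean] using h

/-- Adding independent zero-mean noise to a function of `X` does not change its integrals over
the events determined by `X`. -/
lemma setIntegral_snd_map_prodMk_add_of_indepFun
    {Ω E : Type*} [MeasurableSpace Ω] [MeasurableSpace E] {P : Measure Ω}
    {X : Ω → E} (hX : Measurable X) {U : Ω → ℝ} (hU : Integrable U P)
    (hmean : ∫ ω, U ω ∂P = 0) (hindep : IndepFun U X P) {f : E → ℝ} (hf : Measurable f)
    (hfX : Integrable (fun ω => f (X ω)) P) {s : Set E} (hs : MeasurableSet s) :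
    ∫ z in Prod.fst ⁻¹' s, z.2 ∂P.map (fun ω => (X ω, f (X ω) + U ω))
      = ∫ x in s, f x ∂P.map X := by
  have hpair : AEMeasurable (fun ω => (X ω, f (X ω) + U ω)) P :=
    hX.aemeasurable.prodMk (hfX.add hU).aemeasurable
  rw [setIntegral_map (measurable_fst hs) measurable_snd.aestronglyMeasurable hpair,
    setIntegral_map hs hf.aestronglyMeasurable hX.aemeasurable]
  change ∫ ω in X ⁻¹' s, f (X ω) + U ω ∂P = _
  rw [integral_add hfX.integrableOn hU.integrableOn,
    setIntegral_preimage_eq_zero_of_indepFun hX hU hmean hindep hs, add_zero]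

/-- Disentangling a structural function from zero-mean noise independent of the
covariates: if the law of `(C, f(C) + U)` equals the law of `(C', g(C') + U')`, with
`U, U'` integrable, zero-mean and independent of `C, C'` respectively, then the laws of
the covariates agree and `f = g` almost everywhere w.r.t. that law. -/
theorem structural_function_identifiable
    {Ω Ω' : Type*} [MeasurableSpace Ω] [MeasurableSpace Ω']
    (P : Measure Ω) (P' : Measure Ω')
    [IsProbabilityMeasure P] [IsProbabilityMeasure P']
    (d : ℕ)
    (C : Ω → Fin d → ℝ) (hC : Measurable C)
    (U : Ω → ℝ) (hUint : Integrable U P) (hUmean : ∫ ω, U ω ∂P = 0)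
    (hindep : IndepFun U C P)
    (f : (Fin d → ℝ) → ℝ) (hf : Measurable f)
    (hfCint : Integrable (fun ω => f (C ω)) P)
    (C' : Ω' → Fin d → ℝ) (hC' : Measurable C')
    (U' : Ω' → ℝ) (hUint' : Integrable U' P') (hUmean' : ∫ ω, U' ω ∂P' = 0)
    (hindep' : IndepFun U' C' P')
    (g : (Fin d → ℝ) → ℝ) (hg : Measurable g)
    (hgCint : Integrable (fun ω => g (C' ω)) P')
    (hlaw : P.map (fun ω => (C ω, f (C ω) + U ω))
          = P'.map (fun ω => (C' ω, g (C' ω) + U' ω))) :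
    P.map C = P'.map C' ∧ f =ᵐ[P.map C] g := by
  have hpair : AEMeasurable (fun ω => (C ω, f (C ω) + U ω)) P :=
    hC.aemeasurable.prodMk (hfCint.add hUint).aemeasurable
  have hpair' : AEMeasurable (fun ω => (C' ω, g (C' ω) + U' ω)) P' :=
    hC'.aemeasurable.prodMk (hgCint.add hUint').aemeasurable
  have hmarg : P.map C = P'.map C' := by
    have h := congrArg (Measure.map Prod.fst) hlaw
    rwa [AEMeasurable.map_map_of_aemeasurable measurable_fst.aemeasurable hpair,
      AEMeasurable.map_map_of_aemeasurable measurable_fst.aemeasurable hpair'] at h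
  refine ⟨hmarg, Integrable.ae_eq_of_forall_setIntegral_eq f g ?_ ?_ fun s hs _ => ?_⟩
  · exact (integrable_map_measure hf.aestronglyMeasurable hC.aemeasurable).2 hfCint
  · rw [hmarg]
    exact (integrable_map_measure hg.aestronglyMeasurable hC'.aemeasurable).2 hgCint
  · rw [← setIntegral_snd_map_prodMk_add_of_indepFun hC hUint hUmean hindep hf hfCint hs, hlaw,
      hmarg, setIntegral_snd_map_prodMk_add_of_indepFun hC' hUint' hUmean' hindep' hg hgCint hs]
end
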